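/- Fix n ≥ 1 and a point z ∈ ℂⁿ with z_k ≠ 0 for every k. Let V = {v ∈ ℂⁿ : Re(conj(z_k)·v_k) = Re(conj(z_l)·v_l) for all k, l, and Im(∑_k v_k/z_k) = 0} (the solution space of the linearized defining equations of the Harvey–Lawson filling at z). Then V is a real-linear subspace of ℂⁿ of real dimension n, and the standard symplectic form vanishes identically on V: Im⟪v,w⟫ = 0 for all v, w ∈ V. That is, V is a Lagrangian subspace of (ℂⁿ, ω), so the Harvey–Lawson filling is a Lagrangian submanifold at each of its points with all coordinates nonzero. -/

import Mathlib

open Complex ComplexConjugate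

/-- The solution space of the linearized defining equations of the Harvey–Lawson filling
at `z`. -/
def harveyLawsonTangentSpace {ι : Type*} [Fintype ι] (z : ι → ℂ) : Submodule ℝ (ι → ℂ) where
  carrier := {v | (∀ k l, (conj (z k) * v k).re = (conj (z l) * v l).re) ∧
    (∑ k, v k / z k).im = 0}
  zero_mem' := by simp
  add_mem' := by
    rintro v w ⟨hv, hv'⟩ ⟨hw, hw'⟩
    refine ⟨fun k l => ?_, ?_⟩
    · simp only [Pi.add_apply, mul_add, add_re, hv k l, hw k l]
    · simp only [Pi.add_apply, add_div, Finset.sum_add_distrib, add_im, hv', hw', add_zero]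
  smul_mem' := by
    rintro c v ⟨hv, hv'⟩
    refine ⟨fun k l => ?_, ?_⟩
    · simp only [Pi.smul_apply, mul_smul_comm, smul_re, hv k l]
    · simp only [Pi.smul_apply, smul_div_assoc, ← Finset.smul_sum, smul_im, hv', smul_zero]

lemma Complex.div_im_eq_conj_mul_im_div (v z : ℂ) : (v / z).im = (conj z * v).im / normSq z := by
  rw [div_im, mul_im, conj_re, conj_im]
  ring

lemma Complex.conj_mul_im_eq_div {z : ℂ} (hz : z ≠ 0) (v w : ℂ) :
    (conj v * w).im = ((conj z * v).re * ((conj z * w).im / normSq z)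
      - (conj z * w).re * ((conj z * v).im / normSq z)) := by
  have h : normSq z ≠ 0 := normSq_eq_zero.not.mpr hz
  field_simp
  simp only [normSq_apply, mul_re, mul_im, conj_re, conj_im]
  ring

namespace harveyLawsonTangentSpace

variable {ι : Type*} [Fintype ι] {z v w : ι → ℂ}

lemma mem_iff : v ∈ harveyLawsonTangentSpace z ↔
    (∀ k l, (conj (z k) * v k).re = (conj (z l) * v l).re) ∧
      ∑ k, (conj (z k) * v k).im / normSq (z k) = 0 := by
  simp only [← div_im_eq_conj_mul_im_div, ← im_sum]
  rfl

/-- The standard symplectic form vanishes on the tangent space. -/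
lemma sum_conj_mul_im_eq_zero (hz : ∀ k, z k ≠ 0) (hv : v ∈ harveyLawsonTangentSpace z)
    (hw : w ∈ harveyLawsonTangentSpace z) : (∑ k, conj (v k) * w k).im = 0 := by
  rw [mem_iff] at hv hw
  rw [im_sum]
  rcases isEmpty_or_nonempty ι with _ | ⟨⟨l⟩⟩
  · simp
  · simp only [fun k => conj_mul_im_eq_div (hz k) (v k) (w k), fun k => hv.1 k l,
      fun k => hw.1 k l, Finset.sum_sub_distrib, ← Finset.mul_sum, hv.2, hw.2, mul_zero, sub_zero]

/-- If `conj (z k) * v k = x + i y k`, this sends `v` to the vector with coordinates `x + y k`. -/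
def toReal (z : ι → ℂ) : harveyLawsonTangentSpace z →ₗ[ℝ] ι → ℝ where
  toFun v k := (conj (z k) * v.1 k).re + (conj (z k) * v.1 k).im
  map_add' v w := by
    ext k
    simp only [Submodule.coe_add, Pi.add_apply, mul_add, add_re, add_im]
    ring
  map_smul' c v := by
    ext k
    simp only [Submodule.coe_smul, Pi.smul_apply, mul_smul_comm, smul_re, smul_im,
      RingHom.id_apply, smul_add]

lemma sum_inv_normSq_pos [Nonempty ι] (hz : ∀ k, z k ≠ 0) : 0 < ∑ k, (normSq (z k))⁻¹ :=
  Finset.sum_pos (fun k _ => inv_pos.mpr (normSq_pos.mpr (hz k))) Finset.univ_nonempty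

lemma toReal_injective (hz : ∀ k, z k ≠ 0) : Function.Injective (toReal z) := by
  rw [← LinearMap.ker_eq_bot, LinearMap.ker_eq_bot']
  rintro ⟨v, hv⟩ h
  rw [mem_iff] at hv
  ext l
  have : Nonempty ι := ⟨l⟩
  have him (k : ι) : (conj (z k) * v k).im = -(conj (z l) * v l).re := by
    rw [← hv.1 k l]
    exact eq_neg_of_add_eq_zero_right (congrFun h k)
  have hre : (conj (z l) * v l).re = 0 := by
    have hsum := hv.2
    simp only [him, div_eq_mul_inv, ← Finset.mul_sum] at hsum
    exact neg_eq_zero.mp ((mul_eq_zero.mp hsum).resolve_right (sum_inv_normSq_pos hz).ne')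
  have hmul : conj (z l) * v l = 0 := Complex.ext hre (by rw [him, hre, neg_zero, zero_im])
  simpa [hz l] using hmul

lemma toReal_surjective (hz : ∀ k, z k ≠ 0) : Function.Surjective (toReal z) := by
  intro t
  rcases isEmpty_or_nonempty ι with _ | _
  · exact ⟨0, Subsingleton.elim _ _⟩
  have hS := (sum_inv_normSq_pos hz).ne'
  set x : ℝ := (∑ k, t k * (normSq (z k))⁻¹) / ∑ k, (normSq (z k))⁻¹ with hx
  have hconj (k : ι) : conj (z k) * ((⟨x, t k - x⟩ : ℂ) / conj (z k)) = ⟨x, t k - x⟩ :=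
    mul_div_cancel₀ _ ((map_ne_zero _).mpr (hz k))
  refine ⟨⟨fun k => (⟨x, t k - x⟩ : ℂ) / conj (z k), mem_iff.mpr ⟨fun k l => ?_, ?_⟩⟩, ?_⟩
  · simp only [hconj]
  · simp only [hconj]
    simp only [div_eq_mul_inv (_ - x), sub_mul, Finset.sum_sub_distrib, ← Finset.mul_sum]
    rw [hx, div_mul_cancel₀ _ hS, sub_self]
  · ext k
    simp only [toReal, LinearMap.coe_mk, AddHom.coe_mk, hconj, add_sub_cancel]

lemma finrank_eq_card (hz : ∀ k, z k ≠ 0) :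
    Module.finrank ℝ (harveyLawsonTangentSpace z) = Fintype.card ι := by
  rw [(LinearEquiv.ofBijective (toReal z) ⟨toReal_injective hz, toReal_surjective hz⟩).finrank_eq,
    Module.finrank_fintype_fun_eq_card]

end harveyLawsonTangentSpace

/-- At a point z with all coordinates nonzero, the solution space V of the linearized
defining equations of the Harvey–Lawson filling (Re(conj(z_k)v_k) all equal, and
Im(∑ v_k/z_k) = 0) is a real-linear subspace of ℂⁿ of real dimension n on which the
standard symplectic form ω(v,w) = Im⟪v,w⟫ vanishes identically: V is a Lagrangian
subspace of (ℂⁿ, ω). -/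
theorem harvey_lawson_tangent_space_lagrangian (n : ℕ) (hn : 1 ≤ n) (z : Fin n → ℂ)
    (hz : ∀ k, z k ≠ 0) :
    ∃ W : Submodule ℝ (Fin n → ℂ),
      (W : Set (Fin n → ℂ)) =
        {v | (∀ k l, ((starRingEnd ℂ) (z k) * v k).re =
                ((starRingEnd ℂ) (z l) * v l).re) ∧
             (∑ k, v k / z k).im = 0} ∧
      Module.finrank ℝ W = n ∧
      ∀ v ∈ W, ∀ w ∈ W, (∑ k, (starRingEnd ℂ) (v k) * w k).im = 0 := by
  exact ⟨harveyLawsonTangentSpace z, rfl,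
    (harveyLawsonTangentSpace.finrank_eq_card hz).trans (Fintype.card_fin n),
    fun _ hv _ hw => harveyLawsonTangentSpace.sum_conj_mul_im_eq_zero hz hv hw⟩
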